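/- Let Q : EuclideanSpace ℝ (Fin d) → ℝ be differentiable, let β ∈ EuclideanSpace ℝ (Fin d), let j be a coordinate, and let ρ₋ > 0, δ > 0. Assume the lower curvature bound along coordinate j: Q(β + η e_j) − Q(β) − η·(∇Q(β))_j ≥ (ρ₋/2)·η² for every η ∈ ℝ. If there exists η ∈ ℝ with Q(β) − Q(β + η e_j) ≥ δ, then |(∇Q(β))_j| ≥ √(2·ρ₋·δ). -/

import Mathlib

open Finset Real RealInnerProductSpace

noncomputable section

/-- The `j`-th standard basis vector of `EuclideanSpace ℝ (Fin d)`. -/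
def eb (d : ℕ) (j : Fin d) : EuclideanSpace ℝ (Fin d) := EuclideanSpace.single j 1

theorem foba_lemma_obj_lower {d : ℕ} (hd : 0 < d)
    (Q : EuclideanSpace ℝ (Fin d) → ℝ) (hQ : Differentiable ℝ Q)
    (β : EuclideanSpace ℝ (Fin d)) (j : Fin d) (ρm δ : ℝ)
    (hρm : 0 < ρm) (hδ : 0 < δ)
    (hcurv : ∀ η : ℝ, Q (β + η • eb d j) - Q β - η * gradient Q β j ≥ ρm / 2 * η ^ 2)
    (hdec : ∃ η : ℝ, Q β - Q (β + η • eb d j) ≥ δ) :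
    |gradient Q β j| ≥ Real.sqrt (2 * ρm * δ) := by
  obtain ⟨η, hη⟩ := hdec
  have hc := hcurv η
  generalize gradient Q β j = g at hc ⊢
  refine Real.sqrt_le_iff.mpr ⟨abs_nonneg g, ?_⟩
  rw [sq_abs]
  have h : δ ≤ -(η * g) - ρm / 2 * η ^ 2 := by linarith
  have h' := mul_le_mul_of_nonneg_left h hρm.le
  nlinarith [sq_nonneg (g + ρm * η)]

end
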